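/- arXiv:1206.5114 — 6 statements merged into one kernel-verified Lean document; each statement's English description precedes it below -/
import Mathlib

section
/- Let n ≥ 1, let A be an n×n integer matrix, and let m : Fin n → ℕ with m i > 1 for all i, the m i pairwise coprime, and such that for every row index i there exists a column index j with gcd(A i j, m i) = 1. Then for every integer vector b : Fin n → ℤ there exists an integer vector x : Fin n → ℤ such that for every i, (m i : ℤ) divides (∑ j, A i j * x j) - b i. -/
/-- Multivariable Chinese Remainder Theorem (solvability). -/
theorem multivariable_CRT_solvable (n : ℕ) (hn : 1 ≤ n)
    (A : Matrix (Fin n) (Fin n) ℤ) (m : Fin n → ℕ)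
    (hm : ∀ i, 1 < m i)
    (hcop : ∀ i j, i ≠ j → Nat.Coprime (m i) (m j))
    (hrow : ∀ i, ∃ j, Int.gcd (A i j) (m i) = 1) :
    ∀ b : Fin n → ℤ, ∃ x : Fin n → ℤ,
      ∀ i, (m i : ℤ) ∣ (∑ j, A i j * x j) - b i := by
  intro b
  have hloc : ∀ i, ∃ y : Fin n → ℤ, (m i : ℤ) ∣ (∑ j, A i j * y j) - b i := by
    intro i
    obtain ⟨j, hj⟩ := hrow i
    obtain ⟨u, v, huv⟩ := Int.isCoprime_iff_gcd_eq_one.mpr hj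
    refine ⟨Pi.single j (u * b i), ?_⟩
    have h : ∑ k, A i k * (Pi.single j (u * b i) : Fin n → ℤ) k = A i j * (u * b i) := by
      simp [Pi.single_apply]
    rw [h]
    exact ⟨-(v * b i), by linear_combination b i * huv⟩
  choose y hy using hloc
  have hcrt : ∀ j, ∃ r : ℤ, ∀ i, r - y i j ∈ Ideal.span {(m i : ℤ)} := by
    intro j
    refine Ideal.exists_forall_sub_mem_ideal (I := fun i => Ideal.span {(m i : ℤ)}) ?_ (fun i => y i j)
    intro i k hik
    exact (Ideal.isCoprime_span_singleton_iff _ _).mpr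
      (Nat.isCoprime_iff_coprime.mpr (hcop i k hik))
  choose x hx using hcrt
  refine ⟨x, fun i => ?_⟩
  have h1 : (m i : ℤ) ∣ ∑ j, A i j * (x j - y i j) :=
    Finset.dvd_sum fun j _ => Dvd.dvd.mul_left (Ideal.mem_span_singleton.mp (hx j i)) _
  have h2 := dvd_add h1 (hy i)
  have h3 : ∑ j, A i j * (x j - y i j) + (∑ j, A i j * y i j - b i) = ∑ j, A i j * x j - b i := by
    simp only [mul_sub, Finset.sum_sub_distrib]
    ring
  rwa [h3] at h2
end

section
/- Let n ≥ 1, let A be an n×n integer matrix, and let m : Fin n → ℕ with m i > 1 for all i, the m i pairwise coprime, and such that for every row index i there exists a column index j with gcd(A i j, m i) = 1. Then the group homomorphism φ : (Fin n → ℤ) → ∀ i, ZMod (m i) defined by φ(x) i = ((∑ j, A i j * x j : ℤ) : ZMod (m i)) is surjective. -/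
/-- Multivariable CRT: the homomorphism `x ↦ (A x mod m)` is surjective. -/
theorem multivariable_CRT_surjective (n : ℕ) (hn : 1 ≤ n)
    (A : Matrix (Fin n) (Fin n) ℤ) (m : Fin n → ℕ)
    (hm : ∀ i, 1 < m i)
    (hcop : ∀ i j, i ≠ j → Nat.Coprime (m i) (m j))
    (hrow : ∀ i, ∃ j, Int.gcd (A i j) (m i) = 1) :
    Function.Surjective
      (fun (x : Fin n → ℤ) (i : Fin n) => ((∑ j, A i j * x j : ℤ) : ZMod (m i))) := by
  intro y
  choose J hJ using hrow
  have crt : ∀ c : (∀ i, ZMod (m i)), ∃ z : ℤ, ∀ i, (z : ZMod (m i)) = c i := by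
    intro c
    have hp : Pairwise (Function.onFun Nat.Coprime m) := fun i j h => hcop i j h
    obtain ⟨w, hw⟩ := (ZMod.prodEquivPi m hp).surjective c
    obtain ⟨z, rfl⟩ := ZMod.intCast_surjective w
    refine ⟨z, fun i => ?_⟩
    rw [← hw, map_intCast]
    rfl
  have hinv : ∀ i, ∃ b : ZMod (m i), (A i (J i) : ZMod (m i)) * b = 1 := by
    intro i
    have h := Int.gcd_eq_gcd_ab (A i (J i)) (m i)
    rw [hJ i] at h
    refine ⟨(Int.gcdA (A i (J i)) (m i) : ℤ), ?_⟩
    have h2 := congrArg (Int.cast : ℤ → ZMod (m i)) h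
    push_cast at h2
    simpa using h2.symm
  choose b hb using hinv
  choose x hx using fun j => crt (fun i => if j = J i then b i * y i else 0)
  refine ⟨x, funext fun i => ?_⟩
  simp only [Int.cast_sum, Int.cast_mul, hx]
  simp [← mul_assoc, hb]
end

section
/- Let n ≥ 1, let A be an n×n integer matrix, and let m : Fin n → ℕ with m i > 1 for all i, the m i pairwise coprime, and such that for every row index i there exists a column index j with gcd(A i j, m i) = 1. Then the kernel subgroup L_A = {x ∈ ℤ^n : ∀ i, (m i : ℤ) ∣ ∑ j, A i j * x j} has index exactly ∏ i, m i in ℤ^n (as an additive subgroup of Fin n → ℤ). -/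
/-- The kernel lattice `L_A = {x : ℤⁿ | A x ≡ 0 mod m}` as an additive subgroup of `ℤⁿ`. -/
def kernelLattice (n : ℕ) (A : Matrix (Fin n) (Fin n) ℤ) (m : Fin n → ℕ) :
    AddSubgroup (Fin n → ℤ) where
  carrier := {x : Fin n → ℤ | ∀ i, (m i : ℤ) ∣ ∑ j, A i j * x j}
  zero_mem' := by intro i; simp
  add_mem' := by
    intro a b ha hb i
    have h := dvd_add (ha i) (hb i)
    simpa [Pi.add_apply, mul_add, Finset.sum_add_distrib] using h
  neg_mem' := by
    intro a ha i
    have h := (ha i).neg_right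
    simpa [Pi.neg_apply, mul_neg, Finset.sum_neg_distrib] using h

theorem crt_aux (n : ℕ) (m : Fin n → ℕ)
    (hcop : ∀ i j, i ≠ j → Nat.Coprime (m i) (m j)) (z : ∀ i, ZMod (m i)) :
    ∃ t : ℤ, ∀ i, (t : ZMod (m i)) = z i := by
  have hp : Pairwise (Function.onFun Nat.Coprime m) := fun i j h => hcop i j h
  obtain ⟨b, hb⟩ := (ZMod.prodEquivPi m hp).surjective z
  obtain ⟨t, rfl⟩ := ZMod.intCast_surjective b
  refine ⟨t, fun i => ?_⟩
  rw [← hb]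
  simp

/-- The reduction map `x ↦ A x mod m`. -/
def redHom (n : ℕ) (A : Matrix (Fin n) (Fin n) ℤ) (m : Fin n → ℕ) :
    (Fin n → ℤ) →+ (∀ i, ZMod (m i)) where
  toFun x := fun i => ((∑ j, A i j * x j : ℤ) : ZMod (m i))
  map_zero' := by ext i; simp
  map_add' := by
    intro a b
    ext i
    simp [mul_add, Finset.sum_add_distrib]

/-- Multivariable CRT: the kernel lattice has index `∏ i, m i` in `ℤⁿ`. -/
theorem multivariable_CRT_index (n : ℕ) (hn : 1 ≤ n)
    (A : Matrix (Fin n) (Fin n) ℤ) (m : Fin n → ℕ)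
    (hm : ∀ i, 1 < m i)
    (hcop : ∀ i j, i ≠ j → Nat.Coprime (m i) (m j))
    (hrow : ∀ i, ∃ j, Int.gcd (A i j) (m i) = 1) :
    (kernelLattice n A m).index = ∏ i, m i := by
  have hker : kernelLattice n A m = (redHom n A m).ker := by
    ext x
    rw [AddMonoidHom.mem_ker, funext_iff]
    exact forall_congr' fun i => (ZMod.intCast_zmod_eq_zero_iff_dvd _ _).symm
  have hsurj : Function.Surjective (redHom n A m) := by
    intro y
    choose j hj using hrow
    have hu : ∀ i, ∃ u : ZMod (m i), (A i (j i) : ZMod (m i)) * u = 1 := fun i =>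
      ⟨_, ZMod.coe_int_mul_inv_eq_one (Int.isCoprime_iff_gcd_eq_one.mpr (hj i))⟩
    choose u hu using hu
    choose x hx using fun k =>
      crt_aux n m hcop (fun i => if k = j i then u i * y i else 0)
    refine ⟨x, funext fun i => ?_⟩
    change ((∑ k, A i k * x k : ℤ) : ZMod (m i)) = y i
    push_cast
    simp only [hx, mul_ite, mul_zero, Finset.sum_ite_eq', Finset.mem_univ, if_true,
      Finset.sum_ite_eq, ← mul_assoc, hu, one_mul]
  rw [hker, AddSubgroup.index_ker, AddMonoidHom.range_eq_top.mpr hsurj]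
  simp [Nat.card_pi]
end

section
/- Let n ≥ 1, let A be an n×n integer matrix, and let m : Fin n → ℕ with m i > 1 for all i, the m i pairwise coprime, and such that for every row index i there exists a column index j with gcd(A i j, m i) = 1. Then the map induced by x ↦ (residue of ∑ j, A i j * x j mod m i)_i is a group isomorphism from the quotient group ℤ^n / L_A onto the product group ∏ i, ZMod (m i). -/
/-- Multivariable CRT: the map induced on the quotient `ℤⁿ / L_A` by
`x ↦ (∑ j, A i j * x j mod m i)_i` is a group isomorphism onto `∏ i, ZMod (m i)`. -/
theorem multivariable_CRT_quotient_iso (n : ℕ) (hn : 1 ≤ n)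
    (A : Matrix (Fin n) (Fin n) ℤ) (m : Fin n → ℕ)
    (hm : ∀ i, 1 < m i)
    (hcop : ∀ i j, i ≠ j → Nat.Coprime (m i) (m j))
    (hrow : ∀ i, ∃ j, Int.gcd (A i j) (m i) = 1) :
    ∃ e : ((Fin n → ℤ) ⧸ kernelLattice n A m) ≃+ (∀ i, ZMod (m i)),
      ∀ x : Fin n → ℤ,
        e (QuotientAddGroup.mk x) = fun i => ((∑ j, A i j * x j : ℤ) : ZMod (m i)) := by
  classical
  let f : (Fin n → ℤ) →+ (∀ i, ZMod (m i)) :=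
    { toFun := fun x i => ((∑ j, A i j * x j : ℤ) : ZMod (m i))
      map_zero' := by funext i; simp
      map_add' := by
        intro x y
        funext i
        simp [mul_add, Finset.sum_add_distrib] }
  have hker : kernelLattice n A m = f.ker := by
    ext x
    rw [AddMonoidHom.mem_ker]
    constructor
    · intro h
      funext i
      exact (ZMod.intCast_zmod_eq_zero_iff_dvd _ _).2 (h i)
    · intro h i
      exact (ZMod.intCast_zmod_eq_zero_iff_dvd _ _).1 (congrFun h i)
  have hcrt : ∀ z : (∀ i, ZMod (m i)), ∃ t : ℤ, ∀ i, (t : ZMod (m i)) = z i := by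
    intro z
    obtain ⟨w, hw⟩ := (ZMod.prodEquivPi m (fun i j hij => hcop i j hij)).surjective z
    obtain ⟨t, rfl⟩ := ZMod.intCast_surjective w
    refine ⟨t, fun i => ?_⟩
    rw [← hw, map_intCast]
    rfl
  have hsurj : Function.Surjective f := by
    intro y
    choose c hc using hrow
    have hinv : ∀ i, ∃ b : ZMod (m i), (A i (c i) : ZMod (m i)) * b = 1 := by
      intro i
      obtain ⟨u, v, huv⟩ := Int.isCoprime_iff_gcd_eq_one.2 (hc i)
      refine ⟨(u : ZMod (m i)), ?_⟩
      have h := congrArg (Int.cast : ℤ → ZMod (m i)) huv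
      push_cast at h
      rw [ZMod.natCast_self, mul_zero, add_zero] at h
      rw [mul_comm]
      exact h
    choose b hb using hinv
    choose x hx using fun k => hcrt (fun i => if k = c i then b i * y i else 0)
    refine ⟨x, ?_⟩
    funext i
    change ((∑ j, A i j * x j : ℤ) : ZMod (m i)) = y i
    push_cast
    simp only [hx]
    simp [← mul_assoc, hb]
  exact ⟨(QuotientAddGroup.quotientAddEquivOfEq hker).trans
    (QuotientAddGroup.quotientKerEquivOfSurjective f hsurj), fun x => rfl⟩
end

section
/- Let n ≥ 1, let A be an n×n integer matrix, let m : Fin n → ℕ with m i > 1 for all i and the m i pairwise coprime, and suppose j : Fin n → Fin n is a choice of pivot columns satisfying gcd(A i (j i), m i) = 1 for each i. Then for every b : Fin n → ℤ there exist integers t_0, …, t_{n-1} with 0 ≤ t_i < m i such that the vector x = ∑ i, t_i · (∏_{k < i} m k) · e_{j i} (where e_j is the j-th standard basis vector of ℤ^n) satisfies, for every i, (m i : ℤ) ∣ (∑ l, A i l * x l) - b i. -/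
theorem qin_aux (c d m : ℤ) (hm : 0 < m) (h : IsCoprime c m) :
    ∃ v, 0 ≤ v ∧ v < m ∧ m ∣ v * c - d := by
  obtain ⟨u, w, h⟩ := h
  refine ⟨(u * d) % m, Int.emod_nonneg _ hm.ne', Int.emod_lt_of_pos _ hm, ?_⟩
  have h1 := Int.emod_add_mul_ediv (u * d) m
  refine ⟨-(u * d / m) * c - w * d, ?_⟩
  linear_combination c * h1 + d * h

theorem qin_aux2 (n : ℕ) (c : Fin n → Fin n → ℤ) (m : Fin n → ℕ) (hm : ∀ i, 1 < m i)
    (hd : ∀ i k, i < k → (m i : ℤ) ∣ c i k) (hc : ∀ i, IsCoprime (c i i) (m i : ℤ))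
    (b : Fin n → ℤ) (s : ℕ) : s ≤ n → ∃ t : Fin n → ℤ, (∀ i, 0 ≤ t i ∧ t i < m i) ∧
      ∀ i : Fin n, i.val < s → (m i : ℤ) ∣ (∑ k, t k * c i k) - b i := by
  induction s with
  | zero =>
    intro _
    exact ⟨fun _ => 0, fun i => ⟨le_rfl, by have := hm i; show (0:ℤ) < m i; omega⟩, fun i h => by omega⟩
  | succ s ih =>
    intro hs
    obtain ⟨t, ht, hti⟩ := ih (by omega)
    let p : Fin n := ⟨s, hs⟩
    obtain ⟨v, hv0, hv1, hv⟩ := qin_aux (c p p) (b p - ∑ k, t k * c p k + t p * c p p) (m p)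
      (by have := hm p; omega) (hc p)
    have key : ∀ i, ∑ k, Function.update t p v k * c i k
        = ∑ k, t k * c i k + (v - t p) * c i p := by
      intro i
      have : ∀ k, Function.update t p v k * c i k
          = t k * c i k + (if k = p then (v - t p) * c i p else 0) := by
        intro k
        by_cases h : k = p
        · subst h; simp; ring
        · simp [h]
      simp only [this, Finset.sum_add_distrib, Finset.sum_ite_eq', Finset.mem_univ, if_true]
    refine ⟨Function.update t p v, ?_, ?_⟩
    · intro i
      by_cases h : i = p
      · rw [h]; simpa using ⟨hv0, hv1⟩
      · simpa [h] using ht i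
    · intro i hi
      rw [key]
      by_cases h : i = p
      · rw [h]
        convert hv using 1
        ring
      · have h2 : i.val < s := by
          have : i.val ≠ s := fun e => h (Fin.ext e)
          omega
        have := dvd_add (hti i h2) ((hd i p h2).mul_left (v - t p))
        rwa [sub_add_eq_add_sub] at this

/-- Qin Jiushao's successive construction: with pivot columns `j i` coprime to `m i`,
one can build a solution of `A x ≡ b mod m` of the form
`x = ∑ i, t i • (∏_{k < i} m k) • e_{j i}` with `0 ≤ t i < m i`. -/
theorem multivariable_CRT_qin_construction (n : ℕ) (hn : 1 ≤ n)
    (A : Matrix (Fin n) (Fin n) ℤ) (m : Fin n → ℕ)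
    (hm : ∀ i, 1 < m i)
    (hcop : ∀ i j, i ≠ j → Nat.Coprime (m i) (m j))
    (j : Fin n → Fin n)
    (hpiv : ∀ i, Int.gcd (A i (j i)) (m i) = 1) :
    ∀ b : Fin n → ℤ, ∃ t : Fin n → ℤ,
      (∀ i, 0 ≤ t i ∧ t i < m i) ∧
      ∀ i, (m i : ℤ) ∣
        (∑ l, A i l *
          (∑ k, t k * (∏ r ∈ Finset.Iio k, (m r : ℤ)) * (if l = j k then 1 else 0))) - b i := by
  intro b
  obtain ⟨t, ht, h⟩ := qin_aux2 n (fun i k => (∏ r ∈ Finset.Iio k, (m r : ℤ)) * A i (j k)) m hm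
    (fun i k hik => (Finset.dvd_prod_of_mem (fun r => (m r : ℤ)) (Finset.mem_Iio.2 hik)).mul_right _)
    (fun i => IsCoprime.mul_left
      (IsCoprime.prod_left fun r hr => Nat.isCoprime_iff_coprime.2
        (hcop r i (Finset.mem_Iio.1 hr).ne))
      (Int.isCoprime_iff_gcd_eq_one.2 (hpiv i))) b n le_rfl
  refine ⟨t, ht, fun i => ?_⟩
  convert h i i.2 using 2
  simp only [Finset.mul_sum]
  rw [Finset.sum_comm]
  refine Finset.sum_congr rfl fun k _ => ?_
  simp only [mul_ite, mul_one, mul_zero, Finset.sum_ite_eq', Finset.mem_univ, if_true]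
  ring
end

section
/- Let n ≥ 1, let A be an n×n integer matrix, and let m : Fin n → ℕ with m i > 0 for all i. Then the following are equivalent: (1) for every b : Fin n → ℤ there exists x : Fin n → ℤ with (m i : ℤ) ∣ (∑ j, A i j * x j) - b i for all i; (2) the index of the subgroup L_A = {x ∈ ℤ^n : ∀ i, (m i : ℤ) ∣ ∑ j, A i j * x j} in ℤ^n equals ∏ i, m i. -/
/-- Solvability of `A x ≡ b mod m` for every `b` is equivalent to the kernel lattice
having index exactly `∏ i, m i` in `ℤⁿ`. -/
theorem multivariable_CRT_solvable_iff_index (n : ℕ) (hn : 1 ≤ n)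
    (A : Matrix (Fin n) (Fin n) ℤ) (m : Fin n → ℕ)
    (hm : ∀ i, 0 < m i) :
    (∀ b : Fin n → ℤ, ∃ x : Fin n → ℤ,
        ∀ i, (m i : ℤ) ∣ (∑ j, A i j * x j) - b i) ↔
      (kernelLattice n A m).index = ∏ i, m i := by
  have hne : ∀ i, NeZero (m i) := fun i => ⟨(hm i).ne'⟩
  let f : (Fin n → ℤ) →+ (∀ i, ZMod (m i)) :=
    { toFun := fun x i => ((∑ j, A i j * x j : ℤ) : ZMod (m i))
      map_zero' := by ext i; simp
      map_add' := by
        intro x y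
        ext i
        simp [mul_add, Finset.sum_add_distrib] }
  have hf : ∀ x i, f x i = ((∑ j, A i j * x j : ℤ) : ZMod (m i)) := fun _ _ => rfl
  have hker : kernelLattice n A m = f.ker := by
    ext x
    rw [AddMonoidHom.mem_ker, funext_iff]
    refine forall_congr' fun i => ?_
    rw [hf, Pi.zero_apply, ZMod.intCast_zmod_eq_zero_iff_dvd]
  have hcard : Nat.card (∀ i, ZMod (m i)) = ∏ i, m i := by
    rw [Nat.card_pi]
    simp
  have hsurj : (∀ b : Fin n → ℤ, ∃ x : Fin n → ℤ,
        ∀ i, (m i : ℤ) ∣ (∑ j, A i j * x j) - b i) ↔ Function.Surjective f := by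
    have key : ∀ (b x : Fin n → ℤ), (∀ i, (m i : ℤ) ∣ (∑ j, A i j * x j) - b i) ↔
        f x = fun i => ((b i : ℤ) : ZMod (m i)) := by
      intro b x
      rw [funext_iff]
      refine forall_congr' fun i => ?_
      rw [hf, ← ZMod.intCast_zmod_eq_zero_iff_dvd, Int.cast_sub, sub_eq_zero]
    constructor
    · intro h y
      choose b hb using fun i => ZMod.intCast_surjective (y i)
      obtain ⟨x, hx⟩ := h b
      exact ⟨x, ((key b x).1 hx).trans (funext hb)⟩
    · intro h b
      obtain ⟨x, hx⟩ := h fun i => ((b i : ℤ) : ZMod (m i))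
      exact ⟨x, (key b x).2 hx⟩
  rw [hsurj, hker, AddSubgroup.index_ker, ← hcard, ← AddMonoidHom.range_eq_top]
  constructor
  · intro h
    rw [h]
    exact AddSubgroup.card_top
  · intro h
    exact AddSubgroup.eq_top_of_card_eq _ h
end
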